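/- arXiv:2312.02784 — 7 statements merged into one kernel-verified Lean document; each statement's English description precedes it below -/
import Mathlib

section
/- Let H : ℝ → ℝ be three times differentiable and f : ℝ → ℝ be three times differentiable. Define R = 12H² + 6H' and ℬ = H²(1 − f'(R)) + (R·f'(R) − f(R))/6 − H·R'·f''(R), where f'(R) denotes t ↦ f'(R(t)), etc. Then for every t, ℬ' = H·[2H'(1 − f'(R)) + (H·R' − R'')·f''(R) − (R')²·f'''(R)]. -/
/-- For `f(R)` gravity in a spatially flat FRW spacetime, with `R = 12H² + 6H'` and
`ℬ = H²(1 − f_R) + (R f_R − f)/6 − H Ṙ f_RR`, the time derivative of `ℬ` satisfies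
`ℬ' = H·[2H'(1 − f_R) + (HṘ − R̈) f_RR − Ṙ² f_RRR]`. -/
theorem fR_gravity_B_derivative
    (H f R B : ℝ → ℝ)
    (hH1 : Differentiable ℝ H) (hH2 : Differentiable ℝ (deriv H))
    (hH3 : Differentiable ℝ (deriv (deriv H)))
    (hf1 : Differentiable ℝ f) (hf2 : Differentiable ℝ (deriv f))
    (hf3 : Differentiable ℝ (deriv (deriv f)))
    (hR : ∀ t, R t = 12 * H t ^ 2 + 6 * deriv H t)
    (hB : ∀ t, B t = H t ^ 2 * (1 - deriv f (R t))
        + (R t * deriv f (R t) - f (R t)) / 6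
        - H t * deriv R t * deriv (deriv f) (R t)) :
    ∀ t, deriv B t = H t * (2 * deriv H t * (1 - deriv f (R t))
        + (H t * deriv R t - deriv (deriv R) t) * deriv (deriv f) (R t)
        - (deriv R t) ^ 2 * deriv (deriv (deriv f)) (R t)) := by
  have hRfun : R = fun t => 12 * H t ^ 2 + 6 * deriv H t := funext hR
  have hR1 : Differentiable ℝ R := by
    rw [hRfun]
    fun_prop
  have hdR : deriv R = fun t => 24 * (H t * deriv H t) + 6 * deriv (deriv H) t := by
    funext t
    rw [hRfun]
    refine HasDerivAt.deriv (((((hH1 t).hasDerivAt.pow 2).const_mul 12).add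
      ((hH2 t).hasDerivAt.const_mul 6)).congr_deriv ?_)
    push_cast
    ring
  have hR2 : Differentiable ℝ (deriv R) := by
    rw [hdR]
    fun_prop
  intro t
  have hH := (hH1 t).hasDerivAt
  have hRt := (hR1 t).hasDerivAt
  have hf := (hf1 (R t)).hasDerivAt.comp t hRt
  have hf' := (hf2 (R t)).hasDerivAt.comp t hRt
  have hf'' := (hf3 (R t)).hasDerivAt.comp t hRt
  rw [show B = _ from funext hB]
  refine HasDerivAt.deriv (((((hH.pow 2).mul (hf'.const_sub 1)).add
    (((hRt.mul hf').sub hf).div_const 6)).sub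
    ((hH.mul (hR2 t).hasDerivAt).mul hf'')).congr_deriv ?_)
  simp only [Function.comp_apply, Pi.mul_apply, Pi.pow_apply]
  push_cast
  linear_combination (deriv R t * deriv (deriv f) (R t) / 6) * hR t
end

section
/- Let H : ℝ → ℝ be three times differentiable with H(t) ≠ 0 for all t, and f : ℝ → ℝ three times differentiable. Define R = 12H² + 6H' and ℬ = H²(1 − f'(R)) + (R·f'(R) − f(R))/6 − H·R'·f''(R), and define κμ = 3H² − 3ℬ and κp = −3H² − 2H' + 3ℬ + ℬ'/H (the Cotton-gravity Friedmann equations). Then the Friedmann equations of f(R) gravity hold: κμ = 3f'(R)H² − (R·f'(R) − f(R))/2 + 3H·R'·f''(R), and (3H² + 2H')·f'(R) = −[κp + (R')²·f'''(R) + 2H·R'·f''(R) + R''·f''(R) + (f(R) − R·f'(R))/2]. -/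
/-- The Friedmann equations of Cotton gravity with the Codazzi choice
`ℬ = H²(1 − f_R) + (R f_R − f)/6 − H Ṙ f_RR` are the Friedmann equations of
`f(R)` gravity in a spatially flat FRW spacetime. -/
theorem cotton_reproduces_fR_friedmann
    (H f R B kμ kp : ℝ → ℝ)
    (hH1 : Differentiable ℝ H) (hH2 : Differentiable ℝ (deriv H))
    (hH3 : Differentiable ℝ (deriv (deriv H)))
    (hf1 : Differentiable ℝ f) (hf2 : Differentiable ℝ (deriv f))
    (hf3 : Differentiable ℝ (deriv (deriv f)))
    (hHne : ∀ t, H t ≠ 0)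
    (hR : ∀ t, R t = 12 * H t ^ 2 + 6 * deriv H t)
    (hB : ∀ t, B t = H t ^ 2 * (1 - deriv f (R t))
        + (R t * deriv f (R t) - f (R t)) / 6
        - H t * deriv R t * deriv (deriv f) (R t))
    (hμ : ∀ t, kμ t = 3 * H t ^ 2 - 3 * B t)
    (hp : ∀ t, kp t = -3 * H t ^ 2 - 2 * deriv H t + 3 * B t + deriv B t / H t) :
    (∀ t, kμ t = 3 * deriv f (R t) * H t ^ 2
        - (R t * deriv f (R t) - f (R t)) / 2
        + 3 * H t * deriv R t * deriv (deriv f) (R t)) ∧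
    (∀ t, (3 * H t ^ 2 + 2 * deriv H t) * deriv f (R t) =
        -(kp t + (deriv R t) ^ 2 * deriv (deriv (deriv f)) (R t)
          + 2 * H t * deriv R t * deriv (deriv f) (R t)
          + deriv (deriv R) t * deriv (deriv f) (R t)
          + (f (R t) - R t * deriv f (R t)) / 2)) := by
  have hRd : ∀ t, HasDerivAt R (24 * H t * deriv H t + 6 * deriv (deriv H) t) t := by
    intro t
    rw [funext hR]
    refine ((((hH1 t).hasDerivAt.pow 2).const_mul 12).add
      ((hH2 t).hasDerivAt.const_mul 6)).congr_deriv ?_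
    push_cast
    ring
  have hR1 : Differentiable ℝ R := fun t => (hRd t).differentiableAt
  have hR2 : Differentiable ℝ (deriv R) := by
    rw [funext fun t => (hRd t).deriv]
    fun_prop
  refine ⟨fun t => by rw [hμ, hB]; ring, fun t => ?_⟩
  have h0 := (hH1 t).hasDerivAt
  have h1 := (hR1 t).hasDerivAt
  have h2 := (hR2 t).hasDerivAt
  have g0 := (hf1 (R t)).hasDerivAt.comp t h1
  have g1 := (hf2 (R t)).hasDerivAt.comp t h1
  have g2 := (hf3 (R t)).hasDerivAt.comp t h1
  have hBd : deriv B t = H t * (2 * deriv H t * (1 - deriv f (R t))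
      + H t * deriv R t * deriv (deriv f) (R t)
      - deriv (deriv R) t * deriv (deriv f) (R t)
      - (deriv R t) ^ 2 * deriv (deriv (deriv f)) (R t)) := by
    rw [funext hB]
    refine HasDerivAt.deriv ?_
    refine ((((h0.pow 2).mul (g1.const_sub 1)).add (((h1.mul g1).sub g0).div_const 6)).sub
      ((h0.mul h2).mul g2)).congr_deriv ?_
    simp only [Function.comp_apply, Pi.mul_apply, Pi.pow_apply]
    push_cast
    linear_combination (deriv R t * deriv (deriv f) (R t) / 6) * hR t
  rw [hp, hBd, mul_div_cancel_left₀ _ (hHne t), hB]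
  ring
end

section
/- Let H : ℝ → ℝ be three times differentiable and f : ℝ → ℝ three times differentiable. Define the Gauss–Bonnet invariant G = 24(H'·H² + H⁴), let g(t) = f'(G(t)), and define ℬ = (κ/3)·(G·f'(G) − f(G) − 24H³·g'). Then for every t, ℬ' = 8κ·H·[g'·(H³ − 2H·H') − H²·g'']. -/
/-- For Gauss–Bonnet `f(G)` gravity in a spatially flat FRW spacetime, with
`G = 24(H'H² + H⁴)`, `g = f_G ∘ G` and `ℬ = (κ/3)(G f_G − f − 24H³ ġ)`, the
time derivative of `ℬ` satisfies `ℬ' = 8κH[ġ(H³ − 2HH') − H² g̈]`. -/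
theorem fG_gravity_B_derivative
    (κ : ℝ) (H f G g B : ℝ → ℝ)
    (hH1 : Differentiable ℝ H) (hH2 : Differentiable ℝ (deriv H))
    (hH3 : Differentiable ℝ (deriv (deriv H)))
    (hf1 : Differentiable ℝ f) (hf2 : Differentiable ℝ (deriv f))
    (hf3 : Differentiable ℝ (deriv (deriv f)))
    (hG : ∀ t, G t = 24 * (deriv H t * H t ^ 2 + H t ^ 4))
    (hg : ∀ t, g t = deriv f (G t))
    (hB : ∀ t, B t = (κ / 3) * (G t * deriv f (G t) - f (G t)
        - 24 * H t ^ 3 * deriv g t)) :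
    ∀ t, deriv B t = 8 * κ * H t *
        (deriv g t * (H t ^ 3 - 2 * H t * deriv H t) - H t ^ 2 * deriv (deriv g) t) := by
  have hG' : ∀ t, HasDerivAt G
      (24 * (deriv (deriv H) t * H t ^ 2 + 2 * H t * deriv H t ^ 2 + 4 * H t ^ 3 * deriv H t)) t := by
    intro t
    rw [funext hG]
    have h := ((((hH2 t).hasDerivAt.mul ((hH1 t).hasDerivAt.pow 2)).add
      ((hH1 t).hasDerivAt.pow 4)).const_mul 24)
    refine h.congr_deriv ?_
    simp only [Pi.pow_apply]
    push_cast
    ring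
  have hg' : ∀ t, HasDerivAt g (deriv (deriv f) (G t) * deriv G t) t := by
    intro t
    rw [funext hg]
    exact (hf2 (G t)).hasDerivAt.comp t (hG' t).differentiableAt.hasDerivAt
  have hGd : Differentiable ℝ G := fun t => (hG' t).differentiableAt
  have hdG : Differentiable ℝ (deriv G) := by
    rw [funext fun t => (hG' t).deriv]
    fun_prop
  have hdg : Differentiable ℝ (deriv g) := by
    rw [funext fun t => (hg' t).deriv]
    exact (hf3.comp hGd).mul hdG
  intro t
  have hBg : B = fun t => (κ / 3) * (G t * g t - f (G t) - 24 * H t ^ 3 * deriv g t) :=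
    funext fun t => by rw [hB, hg]
  have hgt := (hg' t).differentiableAt.hasDerivAt
  have hGt := (hGd t).hasDerivAt
  have hfG : HasDerivAt (fun t => f (G t)) (g t * deriv G t) t := by
    rw [hg]
    exact (hf1 (G t)).hasDerivAt.comp t hGt
  have hHg := (((hH1 t).hasDerivAt.fun_pow 3).const_mul 24).fun_mul (hdg t).hasDerivAt
  rw [hBg, ((((hGt.fun_mul hgt).fun_sub hfG).fun_sub hHg).const_mul (κ / 3)).deriv, hG]
  push_cast
  ring
end

section
/- Let H : ℝ → ℝ be three times differentiable with H(t) ≠ 0 for all t, and f : ℝ → ℝ three times differentiable. Define G = 24(H'·H² + H⁴), g(t) = f'(G(t)), ℬ = (κ/3)·(G·f'(G) − f(G) − 24H³·g'), and the Cotton-gravity Friedmann values κμ = 3H² − 3ℬ, κp = −3H² − 2H' + 3ℬ + ℬ'/H. Then the Friedmann equations of f(G) gravity hold: κμ = 3H² − κ(G·f'(G) − f(G) − 24H³·g') and κp = −3H² − 2H' + κ(G·f'(G) − f(G)) − 16κ·H·(H² + H')·g' − 8κ·H²·g''. -/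
/-- The Friedmann equations of Cotton gravity with the Codazzi choice
`3ℬ = κ(G f_G − f − 24H³ ḟ_G)` are the Friedmann equations of Gauss–Bonnet
`f(G)` gravity in a spatially flat FRW spacetime. -/
theorem cotton_reproduces_fG_friedmann
    (κ : ℝ) (H f G g B kμ kp : ℝ → ℝ)
    (hH1 : Differentiable ℝ H) (hH2 : Differentiable ℝ (deriv H))
    (hH3 : Differentiable ℝ (deriv (deriv H)))
    (hf1 : Differentiable ℝ f) (hf2 : Differentiable ℝ (deriv f))
    (hf3 : Differentiable ℝ (deriv (deriv f)))
    (hHne : ∀ t, H t ≠ 0)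
    (hG : ∀ t, G t = 24 * (deriv H t * H t ^ 2 + H t ^ 4))
    (hg : ∀ t, g t = deriv f (G t))
    (hB : ∀ t, B t = (κ / 3) * (G t * deriv f (G t) - f (G t)
        - 24 * H t ^ 3 * deriv g t))
    (hμ : ∀ t, kμ t = 3 * H t ^ 2 - 3 * B t)
    (hp : ∀ t, kp t = -3 * H t ^ 2 - 2 * deriv H t + 3 * B t + deriv B t / H t) :
    (∀ t, kμ t = 3 * H t ^ 2
        - κ * (G t * deriv f (G t) - f (G t) - 24 * H t ^ 3 * deriv g t)) ∧
    (∀ t, kp t = -3 * H t ^ 2 - 2 * deriv H t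
        + κ * (G t * deriv f (G t) - f (G t))
        - 16 * κ * H t * (H t ^ 2 + deriv H t) * deriv g t
        - 8 * κ * H t ^ 2 * deriv (deriv g) t) := by
  refine ⟨fun t => by rw [hμ, hB]; ring, fun t => ?_⟩
  have hG' : ∀ t, HasDerivAt G (24 * (deriv (deriv H) t * H t ^ 2
      + deriv H t * (2 * H t * deriv H t) + 4 * H t ^ 3 * deriv H t)) t := fun t => by
    rw [funext hG]
    have h := (hH1 t).hasDerivAt
    refine ((((hH2 t).hasDerivAt.mul (h.pow 2)).add (h.pow 4)).const_mul 24).congr_deriv ?_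
    norm_num
  have hg' : ∀ t, HasDerivAt g (deriv (deriv f) (G t) * deriv G t) t := fun t => by
    rw [funext hg]
    exact (hf2 (G t)).hasDerivAt.comp t (hG' t).differentiableAt.hasDerivAt
  have hGd : Differentiable ℝ G := fun t => (hG' t).differentiableAt
  have hGdd : Differentiable ℝ (deriv G) := by
    rw [funext fun t => (hG' t).deriv]
    fun_prop
  have hgdd : Differentiable ℝ (deriv g) := by
    rw [funext fun t => (hg' t).deriv]
    exact (hf3.comp hGd).mul hGdd
  have hB' : HasDerivAt B ((κ / 3) * (G t * deriv g t - 72 * H t ^ 2 * deriv H t * deriv g t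
      - 24 * H t ^ 3 * deriv (deriv g) t)) t := by
    rw [funext hB]
    simp only [← hg]
    have hGt := (hGd t).hasDerivAt
    have hgt := (hg' t).differentiableAt.hasDerivAt
    have hft := (hf1 (G t)).hasDerivAt.comp t hGt
    refine ((((hGt.mul hgt).sub hft).sub ((((hH1 t).hasDerivAt.pow 3).const_mul 24).mul
      (hgdd t).hasDerivAt)).const_mul (κ / 3)).congr_deriv ?_
    rw [← hg t]
    simp only [Pi.pow_apply]
    push_cast
    ring
  rw [hp, hB'.deriv, hB]
  field_simp [hHne t]
  rw [hG]
  ring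
end

section
/- Let H : ℝ → ℝ be twice differentiable with H(t) ≠ 0 for all t, and f : ℝ → ℝ twice differentiable. Define T = −6H², ℬ = −f(T)/6 − 2f'(T)·H², and the Cotton-gravity Friedmann values κμ = 3H² − 3ℬ, κp = −3H² − 2H' + 3ℬ + ℬ'/H. Then (κ/2)(p + μ) = −H'·(1 + f'(T) − 12H²·f''(T)); in particular, at every t where 1 + f'(T) − 12H²·f''(T) ≠ 0, the second Friedmann equation of f(T) gravity holds: H' = −(1/2)·κ(p + μ)/(1 + f'(T) − 12H²·f''(T)). -/
/-- The derivative of the Codazzi function `ℬ = −f(T)/6 − 2 f_T H²` along `T = −6H²`. -/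
theorem hasDerivAt_codazzi_fT {H f : ℝ → ℝ} {t : ℝ} (hH : DifferentiableAt ℝ H t)
    (hf : DifferentiableAt ℝ f (-6 * H t ^ 2))
    (hf' : DifferentiableAt ℝ (deriv f) (-6 * H t ^ 2)) :
    HasDerivAt (fun s => -f (-6 * H s ^ 2) / 6 - 2 * deriv f (-6 * H s ^ 2) * H s ^ 2)
      (-2 * H t * deriv H t *
        (deriv f (-6 * H t ^ 2) - 12 * H t ^ 2 * deriv (deriv f) (-6 * H t ^ 2))) t := by
  have hsq : HasDerivAt (fun s => H s ^ 2) (2 * H t * deriv H t) t := by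
    simpa using hH.hasDerivAt.fun_pow 2
  have hT : HasDerivAt (fun s => -6 * H s ^ 2) (-6 * (2 * H t * deriv H t)) t :=
    hsq.const_mul (-6)
  have hfT : HasDerivAt (fun s => f (-6 * H s ^ 2))
      (deriv f (-6 * H t ^ 2) * (-6 * (2 * H t * deriv H t))) t :=
    hf.hasDerivAt.comp t hT
  have hf'T : HasDerivAt (fun s => deriv f (-6 * H s ^ 2))
      (deriv (deriv f) (-6 * H t ^ 2) * (-6 * (2 * H t * deriv H t))) t :=
    HasDerivAt.comp (h₂ := deriv f) t hf'.hasDerivAt hT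
  refine ((hfT.fun_neg.div_const 6).fun_sub ((hf'T.const_mul 2).fun_mul hsq)).congr_deriv ?_
  ring

/-- The Friedmann equations of Cotton gravity with the Codazzi choice
`ℬ = −f(T)/6 − 2 f_T H²` give `(κ/2)(p+μ) = −H'(1 + f_T − 12H² f_TT)`; where the
factor is nonzero this is the second Friedmann equation of `f(T)` gravity. -/
theorem cotton_reproduces_fT_friedmann
    (H f T B kμ kp : ℝ → ℝ)
    (hH1 : Differentiable ℝ H) (hH2 : Differentiable ℝ (deriv H))
    (hf1 : Differentiable ℝ f) (hf2 : Differentiable ℝ (deriv f))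
    (hHne : ∀ t, H t ≠ 0)
    (hT : ∀ t, T t = -6 * H t ^ 2)
    (hB : ∀ t, B t = -f (T t) / 6 - 2 * deriv f (T t) * H t ^ 2)
    (hμ : ∀ t, kμ t = 3 * H t ^ 2 - 3 * B t)
    (hp : ∀ t, kp t = -3 * H t ^ 2 - 2 * deriv H t + 3 * B t + deriv B t / H t) :
    (∀ t, (kp t + kμ t) / 2 =
        -deriv H t * (1 + deriv f (T t) - 12 * H t ^ 2 * deriv (deriv f) (T t))) ∧
    (∀ t, 1 + deriv f (T t) - 12 * H t ^ 2 * deriv (deriv f) (T t) ≠ 0 →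
        deriv H t = -(1 / 2) * (kp t + kμ t) /
          (1 + deriv f (T t) - 12 * H t ^ 2 * deriv (deriv f) (T t))) := by
  have key : ∀ t, (kp t + kμ t) / 2 =
      -deriv H t * (1 + deriv f (T t) - 12 * H t ^ 2 * deriv (deriv f) (T t)) := by
    intro t
    obtain rfl : T = fun s => -6 * H s ^ 2 := funext hT
    obtain rfl : B = fun s => -f (-6 * H s ^ 2) / 6 - 2 * deriv f (-6 * H s ^ 2) * H s ^ 2 :=
      funext hB
    rw [hp, hμ, (hasDerivAt_codazzi_fT (hH1 t) (hf1 _) (hf2 _)).deriv]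
    have := hHne t
    field_simp
    ring
  refine ⟨key, fun t ht => ?_⟩
  rw [eq_div_iff ht]
  linear_combination key t
end

section
/- Let H : ℝ → ℝ be differentiable with H(t) ≠ 0 for all t, and let κ, β̃, Λ be real constants. Define ℬ = 2κβ̃·H⁶ and the Cotton-gravity Friedmann values κμ = 3H² − 3ℬ − Λ, κp = −3H² − 2H' + 3ℬ + ℬ'/H + Λ. Then the Friedmann equations of Einsteinian cubic gravity hold: 3H² = κμ + 6κβ̃·H⁶ + Λ and 3H² + 2H' = −κp + 6κβ̃·H⁴·(H² + 2H') + Λ. -/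
/-- The Friedmann equations of Cotton gravity with the Codazzi choice
`ℬ = 2κβ̃H⁶` are the Friedmann equations of Einsteinian cubic gravity. -/
theorem cotton_reproduces_cubic_friedmann
    (κ β Λ : ℝ) (H B kμ kp : ℝ → ℝ)
    (hH : Differentiable ℝ H)
    (hHne : ∀ t, H t ≠ 0)
    (hB : ∀ t, B t = 2 * κ * β * H t ^ 6)
    (hμ : ∀ t, kμ t = 3 * H t ^ 2 - 3 * B t - Λ)
    (hp : ∀ t, kp t = -3 * H t ^ 2 - 2 * deriv H t + 3 * B t + deriv B t / H t + Λ) :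
    (∀ t, 3 * H t ^ 2 = kμ t + 6 * κ * β * H t ^ 6 + Λ) ∧
    (∀ t, 3 * H t ^ 2 + 2 * deriv H t =
        -kp t + 6 * κ * β * H t ^ 4 * (H t ^ 2 + 2 * deriv H t) + Λ) := by
  have hB' : ∀ t, deriv B t = 12 * κ * β * H t ^ 5 * deriv H t := by
    intro t
    rw [funext hB, (((hH t).hasDerivAt.fun_pow 6).const_mul (2 * κ * β)).deriv]
    norm_num
    ring
  refine ⟨fun t => ?_, fun t => ?_⟩
  · rw [hμ, hB]
    ring
  · have := hHne t
    rw [hp, hB', hB]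
    field_simp
    ring
end

section
/- Let a : ℝ → ℝ be positive and twice differentiable, H = a'/a with H(t) ≠ 0 for all t, R⋆, α, β real constants, and J²(t) = H(t)² + R⋆/(6a(t)²). Define ℬ = −(α·(J²)² + β·(J²)³) and the Cotton-gravity Friedmann values κμ = R⋆/(2a²) + 3H² − 3ℬ, κp = −R⋆/(6a²) − 3H² − 2H' + 3ℬ + ℬ'/H. Then the Friedmann equations of cubic Lovelock gravity hold: κμ = 3J²·(1 + α·J² + β·(J²)²) and κ(p + μ) = −2(H' − R⋆/(6a²))·(1 + 2α·J² + 3β·(J²)²). -/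
/-- The Friedmann equations of Cotton gravity with the Codazzi choice
`ℬ = −(α J⁴ + β J⁶)` (with `J² = H² + R⋆/(6a²)`) are the Friedmann equations of
regularized cubic Lovelock gravity. -/
theorem cotton_reproduces_lovelock_friedmann
    (Rstar α β : ℝ) (a H J2 B kμ kp : ℝ → ℝ)
    (ha1 : Differentiable ℝ a) (ha2 : Differentiable ℝ (deriv a))
    (hpos : ∀ t, 0 < a t)
    (hH : ∀ t, H t = deriv a t / a t)
    (hHne : ∀ t, H t ≠ 0)
    (hJ : ∀ t, J2 t = H t ^ 2 + Rstar / (6 * a t ^ 2))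
    (hB : ∀ t, B t = -(α * J2 t ^ 2 + β * J2 t ^ 3))
    (hμ : ∀ t, kμ t = Rstar / (2 * a t ^ 2) + 3 * H t ^ 2 - 3 * B t)
    (hp : ∀ t, kp t = -Rstar / (6 * a t ^ 2) - 3 * H t ^ 2 - 2 * deriv H t
        + 3 * B t + deriv B t / H t) :
    (∀ t, kμ t = 3 * J2 t * (1 + α * J2 t + β * J2 t ^ 2)) ∧
    (∀ t, kp t + kμ t = -2 * (deriv H t - Rstar / (6 * a t ^ 2))
        * (1 + 2 * α * J2 t + 3 * β * J2 t ^ 2)) := by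
  refine ⟨fun t => ?_, fun t => ?_⟩
  · have hat := (hpos t).ne'
    rw [hμ, hB, hJ]
    field_simp
    ring
  · have hat := (hpos t).ne'
    have hHt := hHne t
    have hHd : HasDerivAt H (deriv H t) t := by
      rw [funext hH]
      exact ((ha2 t).div (ha1 t) hat).hasDerivAt
    have had : HasDerivAt a (H t * a t) t := by
      rw [hH, div_mul_cancel₀ _ hat]
      exact (ha1 t).hasDerivAt
    have hJd : HasDerivAt J2 (H t * (2 * deriv H t - Rstar / (3 * a t ^ 2))) t := by
      rw [funext hJ]
      refine ((hHd.fun_pow 2).fun_add ((hasDerivAt_const t Rstar).fun_div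
        ((had.fun_pow 2).const_mul 6) (by positivity))).congr_deriv ?_
      field_simp
      ring
    have hBd : deriv B t = -(2 * α * J2 t + 3 * β * J2 t ^ 2)
        * (H t * (2 * deriv H t - Rstar / (3 * a t ^ 2))) := by
      rw [funext hB]
      refine ((((hJd.fun_pow 2).const_mul α).fun_add
        ((hJd.fun_pow 3).const_mul β)).fun_neg.congr_deriv ?_).deriv
      push_cast
      ring
    rw [hp, hμ, hBd]
    field_simp
    ring
end
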